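/- arXiv:2004.02588 — 2 statements merged into one kernel-verified Lean document; each statement's English description precedes it below -/
import Mathlib

section
/- Let d ∈ {2,3}, let γ > 0, and let 2 < b < ∞ be such that 0 < d/2 - d/b < 1. Set θ = d/2 - d/b. Then there exists a constant C > 0, depending only on d, b and γ, such that for every continuously differentiable function u : ℝ^d → ℝ with ∫_{ℝ^d} |u(x)|^2 w_γ(x) dx < ∞ and ∫_{ℝ^d} |∇u(x)|^2 w_γ(x) dx < ∞, one has ( ∫_{ℝ^d} |u(x)|^b w_γ(x)^{b/2} dx )^{1/b} ≤ C ( (∫_{ℝ^d} |u|^2 w_γ dx)^{1/2} + (∫_{ℝ^d} |∇u|^2 w_γ dx)^{1/2} )^{θ} · ( ∫_{ℝ^d} |u|^2 w_γ dx )^{(1-θ)/2}. -/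
open MeasureTheory

/-- The weight `w_γ(x) = (1+|x|)^{-γ}` on `ℝ^d`. -/
noncomputable def weightFn (d : ℕ) (γ : ℝ) (x : EuclideanSpace ℝ (Fin d)) : ℝ :=
  (1 + ‖x‖) ^ (-γ)

open scoped NNReal ENNReal

/-- The Gagliardo–Nirenberg inequality with exponent `r`, in integral form, for compactly supported
`C¹` functions on `ℝ^d`. -/
def IsGagliardoNirenbergExponent (d : ℕ) (r : ℝ) : Prop :=
  ∃ C : ℝ≥0, ∀ v : EuclideanSpace ℝ (Fin d) → ℝ, ContDiff ℝ 1 v → HasCompactSupport v →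
    ∫⁻ x, ‖v x‖ₑ ^ r ≤ C * ((∫⁻ x, ‖fderiv ℝ v x‖ₑ ^ (2 : ℝ)) ^ (d * (r - 2) / 4)
      * (∫⁻ x, ‖v x‖ₑ ^ (2 : ℝ)) ^ (r / 2 - d * (r - 2) / 4))

theorem exists_lintegral_rpow_le_lintegral_fderiv {d : ℕ} (hd : 0 < d) {p q : ℝ} (hp : 1 ≤ p)
    (hq : 0 < q) (hpq : q⁻¹ = p⁻¹ - (d : ℝ)⁻¹) :
    ∃ C : ℝ≥0, ∀ v : EuclideanSpace ℝ (Fin d) → ℝ, ContDiff ℝ 1 v → HasCompactSupport v →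
      ∫⁻ x, ‖v x‖ₑ ^ q ≤ C * (∫⁻ x, ‖fderiv ℝ v x‖ₑ ^ p) ^ (q / p) := by
  have hp0 : 0 < p := by linarith
  lift p to ℝ≥0 using hp0.le
  lift q to ℝ≥0 using hq.le
  refine ⟨eLpNormLESNormFDerivOfEqInnerConst (volume : Measure (EuclideanSpace ℝ (Fin d))) p
    ^ (q : ℝ), fun v hv hvs => ?_⟩
  have h := eLpNorm_le_eLpNorm_fderiv_of_eq_inner volume hv hvs (p := p) (p' := q)
    (by exact_mod_cast hp) (by simpa using hd) (by simpa using hpq)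
  have hp' : p ≠ 0 := by rintro rfl; simp at hp0
  have hq' : q ≠ 0 := by rintro rfl; simp at hq
  rw [← eLpNorm_nnreal_pow_eq_lintegral hq', ← eLpNorm_nnreal_pow_eq_lintegral hp',
    ← ENNReal.rpow_mul, mul_div_cancel₀ _ hp0.ne', ENNReal.coe_rpow_of_nonneg _ hq.le,
    ← ENNReal.mul_rpow_of_nonneg _ _ hq.le]
  gcongr

theorem isGagliardoNirenbergExponent_two (d : ℕ) : IsGagliardoNirenbergExponent d 2 :=
  ⟨1, fun v _ _ => by simp⟩

theorem isGagliardoNirenbergExponent_three_six : IsGagliardoNirenbergExponent 3 6 := by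
  obtain ⟨C, hC⟩ := exists_lintegral_rpow_le_lintegral_fderiv (d := 3) (p := 2) (q := 6)
    (by norm_num) (by norm_num) (by norm_num) (by norm_num)
  refine ⟨C, fun v hv hvs => (hC v hv hvs).trans_eq ?_⟩
  norm_num

theorem IsGagliardoNirenbergExponent.of_le {d : ℕ} {b r : ℝ} (h : IsGagliardoNirenbergExponent d r)
    (hb : 2 < b) (hbr : b ≤ r) (hr : 0 ≤ r / 2 - d * (r - 2) / 4) :
    IsGagliardoNirenbergExponent d b := by
  obtain ⟨C, hC⟩ := h
  have hr2 : 0 < r - 2 := by linarith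
  set s := (b - 2) / (r - 2) with hs
  have hs0 : 0 ≤ s := div_nonneg (by linarith) hr2.le
  have hs1 : s ≤ 1 := (div_le_one hr2).2 (by linarith)
  have hsb : s * (r - 2) = b - 2 := div_mul_cancel₀ _ hr2.ne'
  refine ⟨C ^ s, fun v hv hvs => ?_⟩
  have hm : AEMeasurable (fun x => ‖v x‖ₑ) := hv.continuous.enorm.measurable.aemeasurable
  set A := ∫⁻ x, ‖v x‖ₑ ^ (2 : ℝ)
  set B := ∫⁻ x, ‖fderiv ℝ v x‖ₑ ^ (2 : ℝ)
  calc ∫⁻ x, ‖v x‖ₑ ^ b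
      = ∫⁻ x, (‖v x‖ₑ ^ r) ^ s * (‖v x‖ₑ ^ (2 : ℝ)) ^ (1 - s) := by
        congr! 2 with x
        rw [← ENNReal.rpow_mul, ← ENNReal.rpow_mul, ← ENNReal.rpow_add_of_nonneg _ _
          (mul_nonneg (by linarith) hs0) (by linarith)]
        congr 1
        linarith
    _ ≤ (∫⁻ x, ‖v x‖ₑ ^ r) ^ s * A ^ (1 - s) :=
        ENNReal.lintegral_mul_norm_pow_le (hm.pow_const _) (hm.pow_const _) hs0 (by linarith)
          (by ring)
    _ ≤ (C * (B ^ (d * (r - 2) / 4) * A ^ (r / 2 - d * (r - 2) / 4))) ^ s * A ^ (1 - s) := by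
        gcongr
        exact hC v hv hvs
    _ = _ := by
        rw [ENNReal.mul_rpow_of_nonneg _ _ hs0, ENNReal.mul_rpow_of_nonneg _ _ hs0,
          ← ENNReal.rpow_mul, ← ENNReal.rpow_mul, ENNReal.coe_rpow_of_nonneg _ hs0, mul_assoc,
          mul_assoc, ← ENNReal.rpow_add_of_nonneg _ _ (mul_nonneg hr hs0) (by linarith)]
        congr 3
        · linear_combination (d / 4 : ℝ) * hsb
        · linear_combination (1 / 2 - d / 4 : ℝ) * hsb

theorem IsGagliardoNirenbergExponent.two_mul {q : ℝ} (h : IsGagliardoNirenbergExponent 2 q)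
    (hq : 2 ≤ q) : IsGagliardoNirenbergExponent 2 (2 * q) := by
  obtain ⟨C, hC⟩ := h
  have hq0 : 0 < q := by linarith
  set p := 2 * q / (q + 2) with hp
  have hp1 : 1 ≤ p := (one_le_div (by linarith)).2 (by linarith)
  have hp0 : 0 < p := by linarith
  obtain ⟨S, hS⟩ := exists_lintegral_rpow_le_lintegral_fderiv (d := 2) (p := p) (q := q)
    (by norm_num) hp1 hq0 (by rw [hp]; push_cast; field_simp; ring)
  have hqp : 0 ≤ q / p := by positivity
  refine ⟨S * (2 ^ p) ^ (q / p) * C, fun v hv hvs => ?_⟩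
  have hm : AEMeasurable (fun x => ‖v x‖ₑ) := hv.continuous.enorm.measurable.aemeasurable
  have hm' : AEMeasurable (fun x => ‖fderiv ℝ v x‖ₑ) :=
    (hv.continuous_fderiv one_ne_zero).enorm.measurable.aemeasurable
  have hCv := hC v hv hvs
  set A := ∫⁻ x, ‖v x‖ₑ ^ (2 : ℝ)
  set B := ∫⁻ x, ‖fderiv ℝ v x‖ₑ ^ (2 : ℝ)
  have hsq : HasCompactSupport (fun x => v x ^ 2) := by
    simpa only [pow_two] using! hvs.mul_right (f' := v)
  calc ∫⁻ x, ‖v x‖ₑ ^ (2 * q)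
      = ∫⁻ x, ‖v x ^ 2‖ₑ ^ q := by
        congr! 2 with x
        rw [enorm_pow, ENNReal.rpow_mul, ENNReal.rpow_two]
    _ ≤ S * (∫⁻ x, ‖fderiv ℝ (fun x => v x ^ 2) x‖ₑ ^ p) ^ (q / p) := hS _ (hv.pow 2) hsq
    _ = S * (∫⁻ x, 2 ^ p * ((‖v x‖ₑ ^ q) ^ (p / q)
          * (‖fderiv ℝ v x‖ₑ ^ (2 : ℝ)) ^ (p / 2))) ^ (q / p) := by
        congr! 4 with x
        rw [fderiv_fun_pow 2 (hv.differentiable one_ne_zero x), enorm_smul, ← ENNReal.rpow_mul,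
          ← ENNReal.rpow_mul, mul_div_cancel₀ _ hq0.ne', mul_div_cancel₀ _ two_ne_zero,
          ← ENNReal.mul_rpow_of_nonneg _ _ hp0.le, ← ENNReal.mul_rpow_of_nonneg _ _ hp0.le,
          ← mul_assoc]
        simp [enorm_mul, show ‖(2 : ℝ)‖ₑ = 2 by simp [Real.enorm_eq_ofReal]]
    _ = S * ((2 ^ p) ^ (q / p) * (∫⁻ x, ((‖v x‖ₑ ^ q) ^ (p / q)
          * (‖fderiv ℝ v x‖ₑ ^ (2 : ℝ)) ^ (p / 2))) ^ (q / p)) := by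
        rw [lintegral_const_mul' _ _ (by finiteness), ENNReal.mul_rpow_of_nonneg _ _ hqp]
    _ ≤ S * ((2 ^ p) ^ (q / p) * ((∫⁻ x, ‖v x‖ₑ ^ q) ^ (p / q) * B ^ (p / 2)) ^ (q / p)) := by
        gcongr
        exact ENNReal.lintegral_mul_norm_pow_le (hm.pow_const _) (hm'.pow_const _) (by positivity)
          (by positivity) (by rw [hp]; field_simp; ring)
    _ = S * ((2 ^ p) ^ (q / p) * ((∫⁻ x, ‖v x‖ₑ ^ q) * B ^ (q / 2))) := by
        rw [ENNReal.mul_rpow_of_nonneg _ _ hqp, ← ENNReal.rpow_mul _ (p / q),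
          ← ENNReal.rpow_mul _ (p / 2), show p / q * (q / p) = 1 by field_simp,
          show p / 2 * (q / p) = q / 2 by field_simp,
          ENNReal.rpow_one]
    _ ≤ S * ((2 ^ p) ^ (q / p) * (C * (B ^ ((2 : ℕ) * (q - 2) / 4)
          * A ^ (q / 2 - (2 : ℕ) * (q - 2) / 4)) * B ^ (q / 2))) := by
        gcongr
    _ = (S * (2 ^ p) ^ (q / p) * C) * ((B ^ ((2 : ℕ) * (q - 2) / 4) * B ^ (q / 2))
          * A ^ (q / 2 - (2 : ℕ) * (q - 2) / 4)) := by ring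
    _ = _ := by
        rw [← ENNReal.rpow_add_of_nonneg _ _ (by push_cast; linarith) (by positivity)]
        push_cast
        rw [ENNReal.coe_rpow_of_nonneg _ hqp, ENNReal.coe_rpow_of_nonneg _ hp0.le]
        push_cast
        ring_nf

theorem isGagliardoNirenbergExponent_two_two_pow (n : ℕ) :
    IsGagliardoNirenbergExponent 2 (2 ^ (n + 1)) := by
  induction n with
  | zero => simpa using isGagliardoNirenbergExponent_two 2
  | succ n ih =>
    rw [pow_succ']
    refine ih.two_mul ?_
    rw [pow_succ']
    linarith [one_le_pow₀ (one_le_two : (1 : ℝ) ≤ 2) (n := n)]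

theorem isGagliardoNirenbergExponent_of_lt {d : ℕ} (hd : d = 2 ∨ d = 3) {b : ℝ} (hb : 2 < b)
    (h : (d : ℝ) / 2 - d / b < 1) : IsGagliardoNirenbergExponent d b := by
  have hb0 : 0 < b := by linarith
  rcases hd with rfl | rfl
  · obtain ⟨n, hn⟩ := pow_unbounded_of_one_lt b (one_lt_two : (1 : ℝ) < 2)
    refine (isGagliardoNirenbergExponent_two_two_pow n).of_le hb ?_ ?_
    · exact hn.le.trans (pow_le_pow_right₀ one_le_two n.le_succ)
    · push_cast
      linarith
  · refine isGagliardoNirenbergExponent_three_six.of_le hb ?_ (by norm_num)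
    push_cast at h
    have h3 : 3 / b * b = 3 := div_mul_cancel₀ _ hb0.ne'
    nlinarith

theorem weightFn_nonneg (d : ℕ) (γ : ℝ) (x : EuclideanSpace ℝ (Fin d)) : 0 ≤ weightFn d γ x := by
  unfold weightFn
  positivity

/-- The square root of the weight is comparable to a `C¹` function whose gradient it controls. -/
theorem exists_contDiff_comparable_sqrt_weightFn (d : ℕ) {γ : ℝ} (hγ : 0 < γ) :
    ∃ K : ℝ, 0 ≤ K ∧ ∃ ρ : EuclideanSpace ℝ (Fin d) → ℝ, ContDiff ℝ 1 ρ ∧ ∀ x,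
      √(weightFn d γ x) ≤ ρ x ∧ ρ x ≤ K * √(weightFn d γ x) ∧
      ‖fderiv ℝ ρ x‖ ≤ K * √(weightFn d γ x) := by
  have hpos : ∀ x : EuclideanSpace ℝ (Fin d), 0 < 1 + ‖x‖ ^ 2 := fun x => by positivity
  have hsqrt : ∀ x : EuclideanSpace ℝ (Fin d),
      √(weightFn d γ x) = ((1 + ‖x‖) ^ 2) ^ (-(γ / 4)) := fun x => by
    rw [weightFn, Real.sqrt_eq_rpow, ← Real.rpow_mul (by positivity), ← Real.rpow_natCast,
      ← Real.rpow_mul (by positivity)]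
    congr 1
    push_cast
    ring
  have hle : ∀ x : EuclideanSpace ℝ (Fin d),
      (1 + ‖x‖ ^ 2) ^ (-(γ / 4)) ≤ 2 ^ (γ / 4) * √(weightFn d γ x) := fun x => by
    have h2 : (2 : ℝ) ^ (γ / 4) = (1 / 2) ^ (-(γ / 4)) := by
      rw [Real.rpow_neg (by norm_num), ← Real.inv_rpow (by norm_num)]
      norm_num
    rw [hsqrt, h2, ← Real.mul_rpow (by norm_num) (by positivity)]
    refine Real.rpow_le_rpow_of_nonpos (by positivity) ?_ (by linarith)
    nlinarith [sq_nonneg (1 - ‖x‖)]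
  refine ⟨2 ^ (γ / 4) * max 1 (γ / 4), by positivity, fun x => (1 + ‖x‖ ^ 2) ^ (-(γ / 4)),
    ?_, fun x => ⟨?_, ?_, ?_⟩⟩
  · exact (contDiff_const.add (contDiff_norm_sq ℝ)).rpow_const_of_ne fun x => (hpos x).ne'
  · rw [hsqrt]
    refine Real.rpow_le_rpow_of_nonpos (hpos x) ?_ (by linarith)
    nlinarith [norm_nonneg x]
  · refine (hle x).trans ?_
    rw [mul_right_comm]
    exact le_mul_of_one_le_right (by positivity) (le_max_left _ _)
  · have hd := (((hasStrictFDerivAt_norm_sq x).hasFDerivAt.const_add 1).rpow_const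
      (p := -(γ / 4)) (Or.inl (hpos x).ne')).fderiv
    rw [hd, norm_smul, ← Nat.cast_smul_eq_nsmul ℝ, norm_smul, innerSL_apply_norm, norm_mul,
      Real.norm_of_nonneg (Real.rpow_nonneg (hpos x).le _), Real.rpow_sub_one (hpos x).ne',
      norm_neg, Real.norm_of_nonneg (by positivity)]
    have h1 : 2 * ‖x‖ / (1 + ‖x‖ ^ 2) ≤ 1 :=
      (div_le_one (hpos x)).2 (by nlinarith [sq_nonneg (1 - ‖x‖)])
    calc _ = (γ / 4) * (1 + ‖x‖ ^ 2) ^ (-(γ / 4)) * (2 * ‖x‖ / (1 + ‖x‖ ^ 2)) := by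
            norm_num
            ring
      _ ≤ (γ / 4) * (1 + ‖x‖ ^ 2) ^ (-(γ / 4)) := mul_le_of_le_one_right (by positivity) h1
      _ ≤ max 1 (γ / 4) * (2 ^ (γ / 4) * √(weightFn d γ x)) := by
            gcongr
            · exact le_max_right _ _
            · exact hle x
      _ = _ := by ring

/-- Smooth cutoff functions exhausting `E`, with uniformly bounded gradients. -/
theorem exists_contDiff_cutoff_seq (E : Type*) [NormedAddCommGroup E] [InnerProductSpace ℝ E]
    [FiniteDimensional ℝ E] :
    ∃ K : ℝ, 0 ≤ K ∧ ∃ χ : ℕ → E → ℝ, ∀ n, ContDiff ℝ 1 (χ n) ∧ HasCompactSupport (χ n) ∧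
      (∀ x, |χ n x| ≤ 1) ∧ (∀ x, ‖fderiv ℝ (χ n) x‖ ≤ K) ∧
      ∀ x, ‖x‖ ≤ n + 1 → χ n x = 1 := by
  let f : ContDiffBump (0 : E) := ⟨1, 2, one_pos, one_lt_two⟩
  have hf : ContDiff ℝ 1 f := f.contDiff
  obtain ⟨K, hK⟩ := (hf.continuous_fderiv one_ne_zero).bounded_above_of_compact_support
    (f.hasCompactSupport.fderiv ℝ)
  refine ⟨K, (norm_nonneg _).trans (hK 0), fun n x => f (((n : ℝ) + 1)⁻¹ • x),
    fun n => ⟨hf.comp (contDiff_const_smul _), ?_, fun x => ?_, fun x => ?_, fun x hx => ?_⟩⟩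
  · exact f.hasCompactSupport.comp_smul (by positivity)
  · rw [abs_of_nonneg f.nonneg]
    exact f.le_one
  · rw [fderiv_comp_smul, norm_smul, Real.norm_of_nonneg (by positivity)]
    refine (mul_le_of_le_one_left (norm_nonneg _) ?_).trans (hK _)
    exact inv_le_one_of_one_le₀ (by linarith [n.cast_nonneg (α := ℝ)])
  · refine f.one_of_mem_closedBall ?_
    rw [mem_closedBall_zero_iff, norm_smul, Real.norm_of_nonneg (by positivity),
      inv_mul_le_iff₀ (by positivity)]
    simpa [f] using hx

theorem integral_le_of_lintegral_ofReal_le {α : Type*} [MeasurableSpace α] {μ : Measure α}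
    {f : α → ℝ} {c : ℝ} (hf : ∀ x, 0 ≤ f x) (hc : 0 ≤ c)
    (h : ∫⁻ x, ENNReal.ofReal (f x) ∂μ ≤ ENNReal.ofReal c) : ∫ x, f x ∂μ ≤ c := by
  by_cases hi : Integrable f μ
  · rw [← ofReal_integral_eq_lintegral_ofReal hi (.of_forall hf)] at h
    exact (ENNReal.ofReal_le_ofReal_iff hc).1 h
  · rwa [integral_undef hi]

theorem lintegral_enorm_rpow_two_le_ofReal_integral {α F : Type*} [MeasurableSpace α]
    {μ : Measure α} [NormedAddCommGroup F] {f : α → F} {g : α → ℝ} (hg : Integrable g μ)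
    (h : ∀ x, ‖f x‖ ^ 2 ≤ g x) :
    ∫⁻ x, ‖f x‖ₑ ^ (2 : ℝ) ∂μ ≤ ENNReal.ofReal (∫ x, g x ∂μ) := by
  rw [ofReal_integral_eq_lintegral_ofReal hg (.of_forall fun x => (sq_nonneg _).trans (h x))]
  refine lintegral_mono fun x => ?_
  rw [← ofReal_norm, ENNReal.rpow_two, ← ENNReal.ofReal_pow (norm_nonneg _)]
  exact ENNReal.ofReal_le_ofReal (h x)

theorem norm_fderiv_mul_mul_le {E : Type*} [NormedAddCommGroup E] [NormedSpace ℝ E]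
    {χ ρ u : E → ℝ} {x : E} (hχ : DifferentiableAt ℝ χ x) (hρ : DifferentiableAt ℝ ρ x)
    (hu : DifferentiableAt ℝ u x) {K L s : ℝ} (hL : 0 ≤ L) (hχ1 : |χ x| ≤ 1)
    (hχL : ‖fderiv ℝ χ x‖ ≤ L) (hρK : |ρ x| ≤ K * s) (hρK' : ‖fderiv ℝ ρ x‖ ≤ K * s) :
    ‖fderiv ℝ (fun y => χ y * (ρ y * u y)) x‖ ≤ K * (1 + L) * s * (|u x| + ‖fderiv ℝ u x‖) := by
  have hKs : 0 ≤ K * s := (abs_nonneg _).trans hρK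
  rw [fderiv_fun_mul hχ (hρ.fun_mul hu), fderiv_fun_mul hρ hu]
  calc _ ≤ |χ x| * (|ρ x| * ‖fderiv ℝ u x‖ + |u x| * ‖fderiv ℝ ρ x‖)
        + |ρ x| * |u x| * ‖fderiv ℝ χ x‖ := by
        refine (norm_add_le _ _).trans ?_
        simp only [norm_smul, norm_mul, Real.norm_eq_abs]
        gcongr
        refine (norm_add_le _ _).trans ?_
        simp only [norm_smul, Real.norm_eq_abs, le_refl]
    _ ≤ 1 * (K * s * ‖fderiv ℝ u x‖ + |u x| * (K * s)) + K * s * |u x| * L := by gcongr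
    _ ≤ 1 * (K * s * ‖fderiv ℝ u x‖ + |u x| * (K * s)) + K * s * |u x| * L
        + K * s * L * ‖fderiv ℝ u x‖ := le_add_of_nonneg_right (by positivity)
    _ = _ := by ring

/-- A Gagliardo–Nirenberg inequality for compactly supported functions implies the corresponding
weighted inequality between integrals. -/
theorem IsGagliardoNirenbergExponent.exists_integral_mul_weightFn_le {d : ℕ} {b γ : ℝ}
    (h : IsGagliardoNirenbergExponent d b) (hγ : 0 < γ) (hb : 2 < b)
    (hb' : 0 ≤ b / 2 - d * (b - 2) / 4) :
    ∃ C : ℝ, 0 ≤ C ∧ ∀ u : EuclideanSpace ℝ (Fin d) → ℝ, ContDiff ℝ 1 u →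
      Integrable (fun x => |u x| ^ (2 : ℝ) * weightFn d γ x) volume →
      Integrable (fun x => ‖fderiv ℝ u x‖ ^ (2 : ℝ) * weightFn d γ x) volume →
      ∫ x, |u x| ^ b * (weightFn d γ x) ^ (b / 2) ≤
        C * (((∫ x, |u x| ^ (2 : ℝ) * weightFn d γ x)
            + ∫ x, ‖fderiv ℝ u x‖ ^ (2 : ℝ) * weightFn d γ x) ^ (d * (b - 2) / 4)
          * (∫ x, |u x| ^ (2 : ℝ) * weightFn d γ x) ^ (b / 2 - d * (b - 2) / 4)) := by
  obtain ⟨C, hC⟩ := h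
  obtain ⟨K, hK, ρ, hρ, hρw⟩ := exists_contDiff_comparable_sqrt_weightFn d hγ
  obtain ⟨L, hL, χ, hχ⟩ := exists_contDiff_cutoff_seq (EuclideanSpace ℝ (Fin d))
  have he : 0 ≤ d * (b - 2) / 4 := by
    have : 0 ≤ b - 2 := by linarith
    positivity
  set e := d * (b - 2) / 4
  set M := 2 * (K * (1 + L)) ^ 2 with hM
  have hM0 : 0 ≤ M := by positivity
  refine ⟨C * (M ^ e * M ^ (b / 2 - e)), by positivity, fun u hu hui hdui => ?_⟩
  have hw := weightFn_nonneg d γ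
  have hA : 0 ≤ ∫ x, |u x| ^ (2 : ℝ) * weightFn d γ x :=
    integral_nonneg fun x => mul_nonneg (by positivity) (hw x)
  have hB : 0 ≤ ∫ x, ‖fderiv ℝ u x‖ ^ (2 : ℝ) * weightFn d γ x :=
    integral_nonneg fun x => mul_nonneg (by positivity) (hw x)
  have hi := (hui.add hdui).const_mul M
  have hsum := integral_add hui hdui
  set A := ∫ x, |u x| ^ (2 : ℝ) * weightFn d γ x with hAdef
  set B := ∫ x, ‖fderiv ℝ u x‖ ^ (2 : ℝ) * weightFn d γ x
  set v : ℕ → EuclideanSpace ℝ (Fin d) → ℝ := fun n x => χ n x * (ρ x * u x)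
  have hv : ∀ n, ContDiff ℝ 1 (v n) := fun n => (hχ n).1.mul (hρ.mul hu)
  have hvs : ∀ n, HasCompactSupport (v n) := fun n => (hχ n).2.1.mul_right
  have hρabs : ∀ x, |ρ x| ≤ K * √(weightFn d γ x) := fun x => by
    rw [abs_of_nonneg ((Real.sqrt_nonneg _).trans (hρw x).1)]
    exact (hρw x).2.1
  have hvA : ∀ n, ∫⁻ x, ‖v n x‖ₑ ^ (2 : ℝ) ≤ ENNReal.ofReal (M * A) := fun n => by
    rw [hAdef, ← integral_const_mul]
    refine lintegral_enorm_rpow_two_le_ofReal_integral (hui.const_mul M) fun x => ?_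
    have h1 : ‖v n x‖ ≤ 1 * (K * √(weightFn d γ x) * |u x|) := by
      simp only [v, norm_mul, Real.norm_eq_abs]
      gcongr
      exacts [(hχ n).2.2.1 x, hρabs x]
    calc ‖v n x‖ ^ 2 ≤ (1 * (K * √(weightFn d γ x) * |u x|)) ^ 2 := by gcongr
      _ = K ^ 2 * 1 * (|u x| ^ (2 : ℝ) * weightFn d γ x) := by
          rw [Real.rpow_two, mul_pow, mul_pow, mul_pow, Real.sq_sqrt (hw x)]
          ring
      _ ≤ K ^ 2 * (2 * (1 + L) ^ 2) * (|u x| ^ (2 : ℝ) * weightFn d γ x) := by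
          have := hw x
          gcongr
          nlinarith
      _ = _ := by rw [hM]; ring
  have hvB : ∀ n, ∫⁻ x, ‖fderiv ℝ (v n) x‖ₑ ^ (2 : ℝ) ≤ ENNReal.ofReal (M * (A + B)) := fun n => by
    rw [← hsum, ← integral_const_mul]
    refine lintegral_enorm_rpow_two_le_ofReal_integral hi fun x => ?_
    have h1 : ‖fderiv ℝ (v n) x‖ ≤ _ := norm_fderiv_mul_mul_le
      ((hχ n).1.differentiable one_ne_zero x) (hρ.differentiable one_ne_zero x)
      (hu.differentiable one_ne_zero x) hL ((hχ n).2.2.1 x) ((hχ n).2.2.2.1 x) (hρabs x) (hρw x).2.2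
    calc ‖fderiv ℝ (v n) x‖ ^ 2
        ≤ (K * (1 + L) * √(weightFn d γ x) * (|u x| + ‖fderiv ℝ u x‖)) ^ 2 := by gcongr
      _ = (K * (1 + L)) ^ 2 * weightFn d γ x * (|u x| + ‖fderiv ℝ u x‖) ^ 2 := by
          rw [mul_pow, mul_pow, Real.sq_sqrt (hw x)]
      _ ≤ (K * (1 + L)) ^ 2 * weightFn d γ x * (2 * (|u x| ^ 2 + ‖fderiv ℝ u x‖ ^ 2)) := by
          have := hw x
          gcongr
          exact add_sq_le
      _ = _ := by
          simp only [Real.rpow_two, hM]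
          ring
  have hlim : ∀ x, ENNReal.ofReal (|u x| ^ b * (weightFn d γ x) ^ (b / 2)) ≤
      Filter.liminf (fun n => ‖v n x‖ₑ ^ b) Filter.atTop := fun x => by
    have hev : (fun n => ‖v n x‖ₑ ^ b) =ᶠ[Filter.atTop] fun _ => ‖ρ x * u x‖ₑ ^ b := by
      obtain ⟨N, hN⟩ := exists_nat_ge ‖x‖
      filter_upwards [Filter.eventually_ge_atTop N] with n hn
      have hn' : (N : ℝ) ≤ n := by exact_mod_cast hn
      simp only [v, (hχ n).2.2.2.2 x (by linarith), one_mul]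
    rw [Filter.liminf_congr hev, Filter.liminf_const, ← ofReal_norm,
      ENNReal.ofReal_rpow_of_nonneg (norm_nonneg _) (by linarith)]
    refine ENNReal.ofReal_le_ofReal ?_
    have hs : (weightFn d γ x) ^ (b / 2) = √(weightFn d γ x) ^ b := by
      rw [Real.sqrt_eq_rpow, ← Real.rpow_mul (hw x)]
      ring_nf
    rw [hs, ← Real.mul_rpow (abs_nonneg _) (Real.sqrt_nonneg _), norm_mul, mul_comm]
    refine Real.rpow_le_rpow (by positivity) ?_ (by linarith)
    exact mul_le_mul_of_nonneg_right ((hρw x).1.trans (le_abs_self _)) (abs_nonneg _)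
  have hbound : ∫⁻ x, ENNReal.ofReal (|u x| ^ b * (weightFn d γ x) ^ (b / 2)) ≤
      C * (ENNReal.ofReal (M * (A + B)) ^ e * ENNReal.ofReal (M * A) ^ (b / 2 - e)) := by
    refine (lintegral_mono hlim).trans ((lintegral_liminf_le fun n =>
      ((hv n).continuous.enorm.measurable.pow_const b)).trans ?_)
    refine Filter.liminf_le_of_frequently_le' (.of_forall fun n => ?_)
    refine (hC _ (hv n) (hvs n)).trans ?_
    gcongr
    exacts [hvB n, hvA n]
  rw [ENNReal.ofReal_rpow_of_nonneg (by positivity) he,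
    ENNReal.ofReal_rpow_of_nonneg (by positivity) hb', ← ENNReal.ofReal_coe_nnreal,
    ← ENNReal.ofReal_mul (by positivity), ← ENNReal.ofReal_mul (by positivity)] at hbound
  refine (integral_le_of_lintegral_ofReal_le (fun x => ?_) (by positivity) hbound).trans_eq ?_
  · exact mul_nonneg (by positivity) (Real.rpow_nonneg (hw x) _)
  · rw [Real.mul_rpow hM0 (by positivity), Real.mul_rpow hM0 hA]
    ring

/-- Weighted Gagliardo–Nirenberg interpolation: for `d ∈ {2,3}`, `γ > 0`,
`2 < b < ∞` with `θ := d/2 - d/b ∈ (0,1)`, there is `C > 0` depending only on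
`d`, `b`, `γ` such that any `C¹` function `u` with `u, ∇u ∈ L²_{w_γ}` satisfies
`(∫ |u|^b w_γ^{b/2})^{1/b} ≤ C (‖u‖_{L²_{w_γ}} + ‖∇u‖_{L²_{w_γ}})^θ (∫ |u|² w_γ)^{(1-θ)/2}`. -/
theorem stmt_9 (d : ℕ) (hd : d = 2 ∨ d = 3) (γ b : ℝ) (hγ : 0 < γ)
    (hb : 2 < b) (hθ0 : 0 < (d : ℝ) / 2 - (d : ℝ) / b)
    (hθ1 : (d : ℝ) / 2 - (d : ℝ) / b < 1) :
    ∃ C > 0, ∀ u : EuclideanSpace ℝ (Fin d) → ℝ, ContDiff ℝ 1 u →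
      Integrable (fun x => |u x| ^ (2 : ℝ) * weightFn d γ x) volume →
      Integrable (fun x => ‖fderiv ℝ u x‖ ^ (2 : ℝ) * weightFn d γ x) volume →
      (∫ x, |u x| ^ b * (weightFn d γ x) ^ (b / 2)) ^ (1 / b)
        ≤ C * ((∫ x, |u x| ^ (2 : ℝ) * weightFn d γ x) ^ (1 / (2 : ℝ))
                + (∫ x, ‖fderiv ℝ u x‖ ^ (2 : ℝ) * weightFn d γ x) ^ (1 / (2 : ℝ)))
              ^ ((d : ℝ) / 2 - (d : ℝ) / b)
            * (∫ x, |u x| ^ (2 : ℝ) * weightFn d γ x)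
              ^ ((1 - ((d : ℝ) / 2 - (d : ℝ) / b)) / 2) := by
  have hb0 : 0 < b := by linarith
  have hdb : (d : ℝ) / b * b = d := div_mul_cancel₀ _ hb0.ne'
  have he : 0 ≤ (b / 2 - d * (b - 2) / 4) := by nlinarith
  obtain ⟨C, hC0, hC⟩ :=
    (isGagliardoNirenbergExponent_of_lt hd hb hθ1).exists_integral_mul_weightFn_le hγ hb he
  refine ⟨C ^ (1 / b) + 1, by positivity, fun u hu hui hdui => ?_⟩
  have h := hC u hu hui hdui
  have hw := weightFn_nonneg d γ
  have hI : 0 ≤ ∫ x, |u x| ^ b * (weightFn d γ x) ^ (b / 2) :=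
    integral_nonneg fun x => mul_nonneg (by positivity) (Real.rpow_nonneg (hw x) _)
  have hA : 0 ≤ ∫ x, |u x| ^ (2 : ℝ) * weightFn d γ x :=
    integral_nonneg fun x => mul_nonneg (by positivity) (hw x)
  have hB : 0 ≤ ∫ x, ‖fderiv ℝ u x‖ ^ (2 : ℝ) * weightFn d γ x :=
    integral_nonneg fun x => mul_nonneg (by positivity) (hw x)
  set A := ∫ x, |u x| ^ (2 : ℝ) * weightFn d γ x
  set B := ∫ x, ‖fderiv ℝ u x‖ ^ (2 : ℝ) * weightFn d γ x
  have h1 : d * (b - 2) / 4 * (1 / b) = 1 / 2 * ((d : ℝ) / 2 - d / b) := by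
    field_simp
    ring
  have h2 : (b / 2 - d * (b - 2) / 4) * (1 / b) = (1 - ((d : ℝ) / 2 - d / b)) / 2 := by
    field_simp
    ring
  calc _ ≤ (C * ((A + B) ^ (d * (b - 2) / 4) * A ^ (b / 2 - d * (b - 2) / 4))) ^ (1 / b) := by
        gcongr
    _ = C ^ (1 / b) * ((A + B) ^ (1 / (2 : ℝ))) ^ ((d : ℝ) / 2 - d / b)
          * A ^ ((1 - ((d : ℝ) / 2 - d / b)) / 2) := by
        rw [Real.mul_rpow hC0 (by positivity), Real.mul_rpow (by positivity) (by positivity),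
          ← Real.rpow_mul (by positivity), ← Real.rpow_mul hA, ← Real.rpow_mul (by positivity),
          h1, h2, mul_assoc]
    _ ≤ _ := by
        gcongr
        · linarith
        · exact Real.rpow_add_le_add_rpow hA hB (by norm_num) (by norm_num)
end

section
/- Let d be a positive integer, let σ > 0, and let μ < d. If P is a polynomial function on ℝ^d (with real coefficients) such that ∫_{ℝ^d} |P(x)|^σ (1+|x|)^{-μ} dx < ∞, then P is identically zero. Equivalently, the weighted space L^σ_{w_μ}(ℝ^d) with μ < d contains no nontrivial polynomials. -/
open MeasureTheory Filter Topology

/-- A real polynomial that is not identically zero is bounded away from zero at infinity. -/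
theorem Polynomial.exists_pos_eventually_le_abs_eval (p : Polynomial ℝ) (hp : p ≠ 0) :
    ∃ c > 0, ∀ᶠ t : ℝ in atTop, c ≤ |p.eval t| := by
  rcases le_or_gt p.degree 0 with h | h
  · rw [Polynomial.eq_C_of_degree_le_zero h] at hp ⊢
    refine ⟨|p.coeff 0|, abs_pos.2 fun h0 => hp (by simp [h0]), ?_⟩
    simp
  · exact ⟨1, one_pos, (p.abs_tendsto_atTop h).eventually_ge_atTop 1⟩

/-- A real polynomial in several variables is bounded away from zero along any ray through a point
where it does not vanish. -/
theorem MvPolynomial.exists_pos_eventually_le_abs_eval_smul {ι : Type*} (P : MvPolynomial ι ℝ)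
    (y : ι → ℝ) (hy : MvPolynomial.eval y P ≠ 0) :
    ∃ c > 0, ∀ᶠ t : ℝ in atTop, c ≤ |MvPolynomial.eval (t • y) P| := by
  let p : Polynomial ℝ := MvPolynomial.aeval (fun i => Polynomial.X * Polynomial.C (y i)) P
  have hp (t : ℝ) : p.eval t = MvPolynomial.eval (t • y) P := by
    have : (Polynomial.aeval t).comp
        (MvPolynomial.aeval (fun i => Polynomial.X * Polynomial.C (y i))) =
        MvPolynomial.aeval (R := ℝ) (t • y) := by
      ext i; simp [mul_comm t]
    simpa [p, MvPolynomial.aeval_eq_eval, Polynomial.coe_aeval_eq_eval] using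
      DFunLike.congr_fun this P
  have hp0 : p ≠ 0 := by
    intro h
    apply hy
    simpa [h] using (hp 1).symm
  simpa only [hp] using p.exists_pos_eventually_le_abs_eval hp0

/-- The weight `(1 + |x|)^(-μ)` decays along rays more slowly than `t^(-d)` when `μ < d`. -/
theorem tendsto_pow_mul_one_add_mul_rpow_neg_atTop (d : ℕ) (hd : 0 < d) (μ : ℝ) (hμ : μ < d)
    (r : ℝ) (hr : 0 ≤ r) :
    Tendsto (fun t : ℝ => t ^ d * (1 + t * r) ^ (-μ)) atTop atTop := by
  have hν : 0 < (d : ℝ) - max μ 0 := by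
    simp [hμ, hd]
  have h := (tendsto_rpow_atTop hν).atTop_mul_const
    (Real.rpow_pos_of_pos (show 0 < 1 + r by linarith) (-max μ 0))
  refine tendsto_atTop_mono' _ ?_ h
  filter_upwards [eventually_ge_atTop 1] with t ht
  have ht0 : 0 < t := by linarith
  have htr : 0 ≤ t * r := by positivity
  calc t ^ ((d : ℝ) - max μ 0) * (1 + r) ^ (-max μ 0)
      = t ^ d * (t * (1 + r)) ^ (-max μ 0) := by
        rw [Real.mul_rpow ht0.le (by linarith), sub_eq_add_neg, Real.rpow_add ht0,
          Real.rpow_natCast, mul_assoc]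
    _ ≤ t ^ d * (1 + t * r) ^ (-max μ 0) := by
        gcongr t ^ d * ?_
        exact Real.rpow_le_rpow_of_nonpos (by linarith) (by linarith) (by simp)
    _ ≤ t ^ d * (1 + t * r) ^ (-μ) := by
        gcongr t ^ d * ?_
        exact Real.rpow_le_rpow_of_exponent_le (by linarith) (by simp)

/-- Dilating the variable by `t > 0` scales a Lebesgue integral over `ℝ^d` by `t^(-d)`. -/
theorem lintegral_ofReal_pow_mul_comp_smul (d : ℕ) (f : EuclideanSpace ℝ (Fin d) → ENNReal)
    (hf : Measurable f) (t : ℝ) (ht : 0 < t) :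
    ∫⁻ x, ENNReal.ofReal (t ^ d) * f (t • x) = ∫⁻ x, f x := by
  have h := lintegral_map (μ := volume) hf (measurable_const_smul (α := EuclideanSpace ℝ (Fin d)) t)
  rw [Measure.map_addHaar_smul _ ht.ne', lintegral_smul_measure] at h
  rw [lintegral_const_mul' _ _ ENNReal.ofReal_ne_top, ← h, smul_eq_mul, ← mul_assoc,
    ← ENNReal.ofReal_mul (by positivity), finrank_euclideanSpace_fin, abs_of_pos (by positivity),
    mul_inv_cancel₀ (by positivity), ENNReal.ofReal_one, one_mul]

/-- For `σ > 0` and `μ < d`, the weighted space `L^σ_{w_μ}(ℝ^d)` contains no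
nontrivial polynomials: if `P` is a real polynomial in `d` variables with
`∫ |P(x)|^σ (1+|x|)^{-μ} dx < ∞`, then `P = 0`. -/
theorem stmt_12 (d : ℕ) (hd : 0 < d) (σ μ : ℝ) (hσ : 0 < σ) (hμ : μ < d)
    (P : MvPolynomial (Fin d) ℝ)
    (hP : ∫⁻ x : EuclideanSpace ℝ (Fin d),
        ENNReal.ofReal (|MvPolynomial.eval (fun i => x i) P| ^ σ * (1 + ‖x‖) ^ (-μ))
      < ⊤) :
    P = 0 := by
  have hcont : Continuous fun x : EuclideanSpace ℝ (Fin d) =>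
      MvPolynomial.eval (fun i => x i) P :=
    P.continuous_eval.comp (by fun_prop)
  set f : EuclideanSpace ℝ (Fin d) → ENNReal := fun x =>
    ENNReal.ofReal (|MvPolynomial.eval (fun i => x i) P| ^ σ * (1 + ‖x‖) ^ (-μ))
  have hf : Measurable f := by
    have := hcont.measurable
    fun_prop
  let g : ℕ → EuclideanSpace ℝ (Fin d) → ENNReal := fun n x =>
    ENNReal.ofReal ((n : ℝ) ^ d) * f ((n : ℝ) • x)
  have hg (n : ℕ) : Measurable (g n) := by fun_prop
  have hlim (x : EuclideanSpace ℝ (Fin d)) (hx : MvPolynomial.eval (fun i => x i) P ≠ 0) :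
      liminf (fun n => g n x) atTop = ⊤ := by
    obtain ⟨c, hc, hcP⟩ := P.exists_pos_eventually_le_abs_eval_smul _ hx
    have h1 := (tendsto_pow_mul_one_add_mul_rpow_neg_atTop d hd μ hμ ‖x‖
      (norm_nonneg x)).const_mul_atTop (Real.rpow_pos_of_pos hc σ)
    have h2 := ENNReal.tendsto_ofReal_atTop.comp (h1.comp (tendsto_natCast_atTop_atTop (R := ℝ)))
    refine (tendsto_nhds_top_mono h2 ?_).liminf_eq
    filter_upwards [tendsto_natCast_atTop_atTop (R := ℝ) |>.eventually hcP] with n hn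
    simp only [Function.comp_apply, g, f]
    rw [← ENNReal.ofReal_mul (by positivity), norm_smul, Real.norm_natCast]
    refine ENNReal.ofReal_le_ofReal ?_
    rw [mul_left_comm]
    gcongr
    exact hn
  have hfin : ∫⁻ x, liminf (fun n => g n x) atTop ≠ ⊤ := by
    refine ((lintegral_liminf_le hg).trans_lt ?_).ne
    have : (fun n => ∫⁻ x, g n x) =ᶠ[atTop] fun _ => ∫⁻ x, f x := by
      filter_upwards [eventually_gt_atTop 0] with n hn
      exact lintegral_ofReal_pow_mul_comp_smul d f hf n (by exact_mod_cast hn)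
    rw [liminf_congr this, liminf_const]
    exact hP
  have hae : (fun x : EuclideanSpace ℝ (Fin d) => MvPolynomial.eval (fun i => x i) P)
      =ᵐ[volume] fun _ => 0 := by
    filter_upwards [ae_lt_top (.liminf hg) hfin] with x hx
    by_contra h
    exact hx.ne (hlim x h)
  have hzero := (hcont.ae_eq_iff_eq volume continuous_const).1 hae
  refine MvPolynomial.funext fun y => ?_
  simpa using congrFun hzero (WithLp.toLp 2 y)
end
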